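/- arXiv:2602.05732 — 12 statements merged into one kernel-verified Lean document; each statement's English description precedes it below -/
import Mathlib

section
/- Assume the Collatz conjecture for the shortcut map, i.e., for every positive integer n there exists an iteration count m with T_0^[m](n) = 1. Then for every positive integer k and every positive integer n there exists an iteration count m with T_k^[m](n) = 3^k. -/
/-- The shortcut `3n + 3^k` Collatz-type map on the natural numbers:
`T k n = (3n + 3^k)/2` for odd `n` and `n/2` for even `n`.  `T 0` is the
shortcut Collatz map. -/
def T (k : ℕ) (n : ℕ) : ℕ := if Odd n then (3 * n + 3 ^ k) / 2 else n / 2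

theorem T_succ_three_mul (k n : ℕ) : T (k + 1) (3 * n) = 3 * T k n := by
  have h3 : Odd (3 ^ k) := Odd.pow (by decide)
  have hodd : Odd (3 * n) ↔ Odd n := by
    rw [Nat.odd_mul]
    exact and_iff_right (by decide)
  unfold T
  simp only [hodd, pow_succ]
  rw [Nat.odd_iff] at h3
  split_ifs with h
  all_goals
    rw [Nat.odd_iff] at h
    omega

theorem T_succ_iterate_three_mul (k m n : ℕ) :
    (T (k + 1))^[m] (3 * n) = 3 * (T k)^[m] n := by
  have h : Function.Semiconj (3 * ·) (T k) (T (k + 1)) :=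
    fun x => (T_succ_three_mul k x).symm
  exact (h.iterate_right m n).symm

theorem T_succ_of_odd (k : ℕ) {n : ℕ} (hn : Odd n) :
    T (k + 1) n = 3 * ((n + 3 ^ k) / 2) := by
  have h3 : Odd (3 ^ k) := Odd.pow (by decide)
  simp only [T, if_pos hn, pow_succ]
  rw [Nat.odd_iff] at h3 hn
  omega

/-- Every orbit of `T (k + 1)` on the positive integers meets the multiples of three. -/
theorem exists_T_succ_iterate_eq_three_mul (k n : ℕ) (hn : 0 < n) :
    ∃ m a : ℕ, 0 < a ∧ (T (k + 1))^[m] n = 3 * a := by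
  induction n using Nat.strong_induction_on with
  | _ n ih =>
    by_cases h : Odd n
    · have h3 : 0 < 3 ^ k := by positivity
      exact ⟨1, (n + 3 ^ k) / 2, by omega, T_succ_of_odd k h⟩
    · have hT : T (k + 1) n = n / 2 := if_neg h
      rw [Nat.odd_iff] at h
      obtain ⟨m, a, ha, hm⟩ := ih (n / 2) (by omega) (by omega)
      exact ⟨m + 1, a, ha, by rw [Function.iterate_succ_apply, hT, hm]⟩

/-- Assuming the Collatz conjecture for the shortcut map `T 0`, every positive
integer reaches `3^k` under iteration of `T k`, for every positive `k`. -/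
theorem Tk_reaches_pow_three
    (hcollatz : ∀ n : ℕ, 0 < n → ∃ m : ℕ, (T 0)^[m] n = 1) :
    ∀ k n : ℕ, 0 < k → 0 < n → ∃ m : ℕ, (T k)^[m] n = 3 ^ k := by
  suffices h : ∀ k n : ℕ, 0 < n → ∃ m : ℕ, (T k)^[m] n = 3 ^ k from
    fun k n _ hn => h k n hn
  intro k
  induction k with
  | zero => simpa using hcollatz
  | succ k ih =>
    intro n hn
    obtain ⟨m, a, ha, hm⟩ := exists_T_succ_iterate_eq_three_mul k n hn
    obtain ⟨l, hl⟩ := ih a ha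
    exact ⟨l + m, by
      rw [Function.iterate_add_apply, hm, T_succ_iterate_three_mul, hl, pow_succ']⟩
end

section
/- For every natural number k and every positive integer n, 3 · T_k(n) = T_{k+1}(3n). -/
/-- For every natural number `k` and positive integer `n`,
`3 · T k n = T (k+1) (3n)`. -/
theorem three_mul_Tk (k : ℕ) (n : ℕ) (hn : 0 < n) :
    3 * T k n = T (k + 1) (3 * n) := by
  have h3 : Odd (3 ^ k) := Odd.pow (by decide)
  have hodd : Odd (3 * n) ↔ Odd n := by simp [Nat.odd_mul, show Odd 3 by decide]
  unfold T
  simp only [hodd, pow_succ]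
  split_ifs with h
  · obtain ⟨a, ha⟩ := h
    obtain ⟨b, hb⟩ := h3
    omega
  · rw [Nat.not_odd_iff_even] at h
    obtain ⟨a, ha⟩ := h
    omega
end

section
/- For every natural number k: T_k(3^k) = 2·3^k and T_k(2·3^k) = 3^k; moreover, assuming that for every positive integer n there exists m with T_0^[m](n) = 1, every positive integer n has some iterate under T_k lying in the cycle {3^k, 2·3^k}. -/
theorem T_of_odd (k : ℕ) {n : ℕ} (hn : Odd n) : T k n = (3 * n + 3 ^ k) / 2 := if_pos hn

theorem T_two_mul (k n : ℕ) : T k (2 * n) = n := by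
  simp [T]

theorem two_mul_T_of_odd (k : ℕ) {n : ℕ} (hn : Odd n) : 2 * T k n = 3 * n + 3 ^ k := by
  have h3 : Odd (3 : ℕ) := by decide
  rw [T_of_odd k hn]
  exact Nat.mul_div_cancel' ((h3.mul hn).add_odd h3.pow).two_dvd

theorem T_pos (k : ℕ) {n : ℕ} (hn : 0 < n) : 0 < T k n := by
  rcases Nat.even_or_odd' n with ⟨c, rfl | rfl⟩
  · rw [T_two_mul]
    lia
  · have := two_mul_T_of_odd k (odd_two_mul_add_one c)
    lia

theorem iterate_T_pos (k m : ℕ) {n : ℕ} (hn : 0 < n) : 0 < (T k)^[m] n := by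
  induction m with
  | zero => exact hn
  | succ m ih =>
    rw [Function.iterate_succ_apply']
    exact T_pos k ih

theorem iterate_T_two_pow_mul (k a b : ℕ) : (T k)^[a] (2 ^ a * b) = b := by
  induction a with
  | zero => simp
  | succ a ih => rw [Function.iterate_succ_apply, pow_succ', mul_assoc, T_two_mul, ih]

/-- Multiplication by `3 ^ k` conjugates `T 0` to `T k`. -/
theorem semiconj_three_pow_mul (k : ℕ) : Function.Semiconj (3 ^ k * ·) (T 0) (T k) := by
  intro n
  have h3 : Odd (3 ^ k) := Odd.pow (by decide)
  rcases Nat.even_or_odd' n with ⟨c, rfl | rfl⟩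
  · simp only [mul_left_comm, T_two_mul]
  · have h0 := two_mul_T_of_odd 0 (odd_two_mul_add_one c)
    have hk := two_mul_T_of_odd k (h3.mul (odd_two_mul_add_one c))
    apply Nat.eq_of_mul_eq_mul_left two_pos
    simp only
    rw [hk, mul_left_comm, h0]
    ring

/-- Every orbit of `T k` reaches a multiple of `3 ^ j` when `j ≤ k`: halving preserves
divisibility by `3 ^ j`, and each odd step gains a factor of `3`. -/
theorem exists_three_pow_dvd_iterate_T {j k : ℕ} (hj : j ≤ k) {n : ℕ} (hn : 0 < n) :
    ∃ m, 3 ^ j ∣ (T k)^[m] n := by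
  induction j with
  | zero => exact ⟨0, by simp⟩
  | succ j ih =>
    obtain ⟨m, hm⟩ := ih (by lia)
    obtain ⟨a, b, hb, hab⟩ := Nat.exists_eq_two_pow_mul_odd (iterate_T_pos k m hn).ne'
    have hjb : 3 ^ j ∣ b := by
      rw [hab] at hm
      exact (Nat.Coprime.pow j a (by norm_num)).dvd_of_dvd_mul_left hm
    refine ⟨1 + (a + m), ?_⟩
    rw [Function.iterate_add_apply, Function.iterate_add_apply, hab, iterate_T_two_pow_mul,
      Function.iterate_one]
    have hcop : Nat.Coprime (3 ^ (j + 1)) 2 := Nat.Coprime.pow_left _ (by norm_num)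
    apply hcop.dvd_of_dvd_mul_left
    rw [two_mul_T_of_odd k hb]
    exact dvd_add (pow_succ' 3 j ▸ mul_dvd_mul_left 3 hjb) (pow_dvd_pow 3 hj)

/-- `3^k → 2·3^k → 3^k` is a cycle of `T k`, and, assuming the Collatz
conjecture for the shortcut map `T 0`, every positive integer has some
`T k`-iterate lying in this cycle. -/
theorem Tk_cycle (k : ℕ) :
    T k (3 ^ k) = 2 * 3 ^ k ∧ T k (2 * 3 ^ k) = 3 ^ k ∧
    ((∀ n : ℕ, 0 < n → ∃ m : ℕ, (T 0)^[m] n = 1) →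
      ∀ n : ℕ, 0 < n → ∃ m : ℕ, (T k)^[m] n ∈ ({3 ^ k, 2 * 3 ^ k} : Set ℕ)) := by
  refine ⟨?_, T_two_mul k _, fun collatz n hn => ?_⟩
  · have h3 : Odd (3 ^ k) := Odd.pow (by decide)
    have := two_mul_T_of_odd k h3
    lia
  · obtain ⟨m, a, ha⟩ := exists_three_pow_dvd_iterate_T le_rfl hn
    have ha0 : 0 < a := Nat.pos_of_mul_pos_left (ha ▸ iterate_T_pos k m hn)
    obtain ⟨l, hl⟩ := collatz a ha0
    refine ⟨l + m, Or.inl ?_⟩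
    have := (semiconj_three_pow_mul k).iterate_right l a
    rw [Function.iterate_add_apply, ha, ← this, hl, mul_one]
end

section
/- For every odd positive integer n and every iteration count m ≥ 1, T_1^[m](n) = 3 · T_0^[m](n + 1). -/
theorem T_one_three_mul (x : ℕ) : T 1 (3 * x) = 3 * T 0 x := by
  unfold T
  rcases Nat.even_or_odd' x with ⟨c, rfl | rfl⟩ <;> split_ifs <;> grind

theorem T_one_of_odd {n : ℕ} (hodd : Odd n) : T 1 n = 3 * T 0 (n + 1) := by
  obtain ⟨c, rfl⟩ := hodd
  unfold T
  split_ifs <;> grind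

/-- For every odd positive integer `n` and every `m ≥ 1`,
`T 1^[m] n = 3 · T 0^[m] (n + 1)`. -/
theorem T1_iterate_eq_three_mul_T0_iterate_succ
    (n : ℕ) (hn : 0 < n) (hodd : Odd n) (m : ℕ) (hm : 1 ≤ m) :
    (T 1)^[m] n = 3 * (T 0)^[m] (n + 1) := by
  obtain ⟨k, rfl⟩ := Nat.exists_eq_add_of_le' hm
  rw [Function.iterate_succ_apply, Function.iterate_succ_apply, T_one_of_odd hodd]
  exact ((Function.Semiconj.iterate_right (f := (3 * ·))
    (fun x => (T_one_three_mul x).symm) k) _).symm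
end

section
/- The rational extension of the shortcut Collatz map T_0 has no nonzero rational periodic point whose reduced denominator is divisible by 3: if q is a nonzero rational number with odd reduced denominator, l ≥ 1, and T_0^[l](q) = q, then 3 does not divide the reduced denominator of q. -/
/-- The rational extension of the shortcut Collatz map: for a rational `q`
(intended to have odd reduced denominator), `T₀ q = (3q+1)/2` if the numerator
of `q` is odd, and `q/2` otherwise. -/
def T0Q (q : ℚ) : ℚ := if Odd q.num then (3 * q + 1) / 2 else q / 2

/-- Iterates of `T0Q` are affine in the starting point, with slope `3 ^ k / 2 ^ l`, and they are
pure halvings when `k = 0`. -/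
theorem exists_two_pow_mul_iterate_T0Q (q : ℚ) (l : ℕ) :
    ∃ k c : ℕ, 2 ^ l * T0Q^[l] q = 3 ^ k * q + c ∧ (k = 0 → c = 0) := by
  induction l with
  | zero => exact ⟨0, 0, by simp⟩
  | succ l ih =>
    obtain ⟨k, c, h, hc⟩ := ih
    rw [Function.iterate_succ_apply']
    generalize T0Q^[l] q = x at h ⊢
    unfold T0Q
    split_ifs
    · refine ⟨k + 1, 3 * c + 2 ^ l, ?_, by simp⟩
      push_cast
      linear_combination 3 * h
    · exact ⟨k, c, by linear_combination h, hc⟩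

/-- The rational shortcut Collatz map has no nonzero rational periodic point
whose reduced denominator is divisible by `3`. -/
theorem not_three_dvd_den_of_periodic (q : ℚ) (hq : q ≠ 0) (hden : Odd q.den)
    (l : ℕ) (hl : 1 ≤ l) (hper : T0Q^[l] q = q) : ¬ (3 ∣ q.den) := by
  obtain ⟨k, c, h, hc⟩ := exists_two_pow_mul_iterate_T0Q q l
  rw [hper] at h
  obtain rfl | hk := Nat.eq_zero_or_pos k
  · have hlt : (1 : ℚ) < 2 ^ l := one_lt_pow₀ one_lt_two (by omega)
    have hmul : ((2 : ℚ) ^ l - 1) * q = 0 := by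
      rw [hc rfl] at h
      push_cast at h
      linear_combination h
    exact absurd hmul (mul_ne_zero (sub_pos.2 hlt).ne' hq)
  · intro h3
    have h3k : (3 : ℤ) ∣ 3 ^ k := dvd_pow_self 3 hk.ne'
    have h2l : ¬ (3 : ℤ) ∣ 2 ^ l := fun hd ↦ by
      have := Int.prime_three.dvd_of_dvd_pow hd
      omega
    have hndvd : ¬ (3 : ℤ) ∣ 2 ^ l - 3 ^ k := fun hd ↦ h2l ((dvd_sub_left h3k).1 hd)
    have hz : ((2 ^ l - 3 ^ k : ℤ) : ℚ) ≠ 0 :=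
      Int.cast_ne_zero.2 fun h0 ↦ hndvd (h0 ▸ dvd_zero 3)
    have hq' : q = (c : ℤ) / ((2 ^ l - 3 ^ k : ℤ) : ℚ) := by
      rw [eq_div_iff hz]
      push_cast
      linear_combination h
    have hdvd : (q.den : ℤ) ∣ 2 ^ l - 3 ^ k := by
      have := Rat.den_dvd (c : ℤ) (2 ^ l - 3 ^ k)
      rwa [Rat.divInt_eq_div, ← hq'] at this
    exact hndvd ((Int.natCast_dvd_natCast.2 h3).trans hdvd)
end

section
/- Every integral cycle of T_k is 3^k times an integral cycle of T_0: if q is a nonzero integer, l ≥ 1, and T_k^[l](q) = q, then 3^k divides q and T_0^[l](q / 3^k) = q / 3^k. -/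
/-- The `3n + 3^k` map on the integers: `T k q = (3q + 3^k)/2` if `q` is odd,
and `q/2` otherwise.  `T 0` is the shortcut Collatz map on the integers. -/
def TZ (k : ℕ) (q : ℤ) : ℤ := if Odd q then (3 * q + 3 ^ k) / 2 else q / 2

/-- Doubling undoes the division in `TZ`. -/
theorem two_mul_TZ (k : ℕ) (q : ℤ) :
    2 * TZ k q = if Odd q then 3 * q + 3 ^ k else q := by
  unfold TZ
  split_ifs with h
  · exact Int.mul_ediv_cancel' (((by decide : Odd (3 : ℤ)).mul h).add_odd
      (Odd.pow (by decide))).two_dvd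
  · exact Int.mul_ediv_cancel' (Int.not_odd_iff_even.mp h).two_dvd

/-- Iterates of `TZ k` are affine in the starting point: here `a` counts the odd steps, and the
translation part vanishes when there are none. -/
theorem exists_two_pow_mul_iterate_TZ (k : ℕ) (q : ℤ) (l : ℕ) :
    ∃ (a : ℕ) (c : ℤ), 2 ^ l * (TZ k)^[l] q = 3 ^ a * q + 3 ^ k * c ∧ (a = 0 → c = 0) := by
  induction l with
  | zero => exact ⟨0, 0, by simp, fun _ => rfl⟩
  | succ l ih =>
    obtain ⟨a, c, h, hc⟩ := ih
    have hstep := two_mul_TZ k ((TZ k)^[l] q)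
    rw [Function.iterate_succ_apply']
    split_ifs at hstep
    · refine ⟨a + 1, 3 * c + 2 ^ l, ?_, by simp⟩
      linear_combination 2 ^ l * hstep + 3 * h
    · refine ⟨a, c, ?_, hc⟩
      linear_combination 2 ^ l * hstep + h

/-- Multiplication by `3 ^ k` intertwines `TZ 0` and `TZ k`. -/
theorem semiconj_three_pow_mul_TZ (k : ℕ) :
    Function.Semiconj (fun m : ℤ => 3 ^ k * m) (TZ 0) (TZ k) := by
  intro m
  have hodd : Odd (3 ^ k * m) ↔ Odd m := by
    rw [Int.odd_mul]
    exact and_iff_right (Odd.pow (by decide))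
  have h₀ := two_mul_TZ 0 m
  have hk := two_mul_TZ k (3 ^ k * m)
  simp only [hodd] at hk
  refine mul_left_cancel₀ (two_ne_zero (α := ℤ)) ?_
  split_ifs at h₀ hk <;> linear_combination 3 ^ k * h₀ - hk

/-- Every nonzero periodic point of `TZ k` is divisible by `3 ^ k`. -/
theorem three_pow_dvd_of_iterate_TZ_eq (k : ℕ) {q : ℤ} (hq : q ≠ 0) {l : ℕ} (hl : 1 ≤ l)
    (hper : (TZ k)^[l] q = q) : (3 ^ k : ℤ) ∣ q := by
  obtain ⟨a, c, h, hc⟩ := exists_two_pow_mul_iterate_TZ k q l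
  rw [hper] at h
  rcases Nat.eq_zero_or_pos a with rfl | ha
  · have hlt : (1 : ℤ) < 2 ^ l := one_lt_pow₀ (by norm_num) (by lia)
    have hmul : (2 ^ l - 1) * q = 0 := by
      rw [hc rfl] at h
      linear_combination h
    exact absurd hmul (mul_ne_zero (by lia) hq)
  · have hcop : IsCoprime (3 : ℤ) (2 ^ l - 3 ^ a) := by
      obtain ⟨b, rfl⟩ := Nat.exists_eq_succ_of_ne_zero ha.ne'
      have h₂ : IsCoprime (3 : ℤ) (2 ^ l) := IsCoprime.pow_right ⟨1, -1, by norm_num⟩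
      have heq : (2 : ℤ) ^ l - 3 ^ (b + 1) = 2 ^ l + 3 * -3 ^ b := by ring
      exact heq ▸ h₂.add_mul_left_right (-3 ^ b)
    exact hcop.pow_left.dvd_of_dvd_mul_left ⟨c, by linear_combination h⟩

/-- Every integral cycle of `T k` is `3^k` times an integral cycle of `T 0`:
if `q ≠ 0` lies on a `T k`-cycle of length `l ≥ 1`, then `3^k ∣ q` and
`q / 3^k` lies on a `T 0`-cycle of length `l`. -/
theorem TkZ_cycle_eq_pow_three_mul (k : ℕ) (q : ℤ) (hq : q ≠ 0) (l : ℕ)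
    (hl : 1 ≤ l) (hper : (TZ k)^[l] q = q) :
    (3 ^ k : ℤ) ∣ q ∧ (TZ 0)^[l] (q / 3 ^ k) = q / 3 ^ k := by
  obtain ⟨m, rfl⟩ := three_pow_dvd_of_iterate_TZ_eq k hq hl hper
  have h₃ : (3 ^ k : ℤ) ≠ 0 := by positivity
  refine ⟨dvd_mul_right _ _, ?_⟩
  rw [Int.mul_ediv_cancel_left _ h₃]
  exact mul_left_cancel₀ h₃ (((semiconj_three_pow_mul_TZ k).iterate_right l m).trans hper)
end

section
/- Every integral cycle of T_0 gives rise, after multiplication by 3^k, to an integral cycle of T_k: if q' is an integer with T_0^[l](q') = q' for some l ≥ 1, then T_k^[l](3^k · q') = 3^k · q'. -/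
/-- Multiplication by `3 ^ k` semiconjugates `T 0` to `T k`. -/
theorem semiconj_pow_three_mul_TZ (k : ℕ) :
    Function.Semiconj (fun q : ℤ => 3 ^ k * q) (TZ 0) (TZ k) := by
  intro q
  have hpow : Odd ((3 : ℤ) ^ k) := Odd.pow (by decide)
  by_cases hq : Odd q
  · have hdvd : (2 : ℤ) ∣ 3 * q + 1 := by
      obtain ⟨m, rfl⟩ := hq
      exact ⟨3 * m + 2, by ring⟩
    simp only [TZ, hq, hpow.mul hq, if_true, pow_zero]
    rw [← Int.mul_ediv_assoc _ hdvd]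
    congr 1
    ring
  · have hdvd : (2 : ℤ) ∣ q := (Int.not_odd_iff_even.mp hq).two_dvd
    have hmul : ¬Odd (3 ^ k * q) := fun h => hq (Int.odd_mul.mp h).2
    simp only [TZ, hq, hmul, if_false]
    rw [Int.mul_ediv_assoc _ hdvd]

/-- Every integral cycle of `T 0` gives, after multiplication by `3^k`, an
integral cycle of `T k`. -/
theorem pow_three_mul_cycle (k : ℕ) (q' : ℤ) (l : ℕ) (hl : 1 ≤ l)
    (hper : (TZ 0)^[l] q' = q') : (TZ k)^[l] (3 ^ k * q') = 3 ^ k * q' := by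
  have h := (semiconj_pow_three_mul_TZ k).iterate_right l q'
  rw [hper] at h
  exact h.symm
end

section
/- For every integer O with O ≡ 1 or O ≡ -1 (mod 6), every rational number q with odd reduced denominator, and every iteration count l, T_O^[l](q) = O · T_0^[l](q / O). -/
/-- The rational extension of the `3n + c` map with odd constant `c`: for a
rational `q` (intended to have odd reduced denominator),
`T c q = (3q + c)/2` if the numerator of `q` is odd, and `q/2` otherwise.
`T 1` is the rational extension of the shortcut Collatz map `T_0`. -/
def TO (c : ℤ) (q : ℚ) : ℚ := if Odd q.num then (3 * q + c) / 2 else q / 2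

theorem Int.cast_ne_zero_of_odd {n : ℤ} (hn : Odd n) : (n : ℚ) ≠ 0 := by
  rw [Int.cast_ne_zero]
  rintro rfl
  exact absurd hn (by decide)

theorem Rat.odd_den_of_mul_eq {q : ℚ} {a b : ℤ} (hb : Odd b) (h : q * b = a) : Odd q.den := by
  have hb0 : (b : ℚ) ≠ 0 := Int.cast_ne_zero_of_odd hb
  have hdvd : (q.den : ℤ) ∣ b := by
    rw [eq_div_of_mul_eq hb0 h, ← Rat.divInt_eq_div]
    exact Rat.den_dvd a b
  obtain ⟨k, rfl⟩ := hdvd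
  exact_mod_cast (Int.odd_mul.mp hb).1

theorem Rat.odd_num_iff_of_mul_eq {q : ℚ} {a b : ℤ} (hb : Odd b) (h : q * b = a) :
    Odd q.num ↔ Odd a := by
  have hden : Odd (q.den : ℤ) := by exact_mod_cast Rat.odd_den_of_mul_eq hb h
  have key : q.num * b = a * q.den := by
    have : (q.num : ℚ) * b = a * q.den := by
      rw [← h, ← Rat.mul_den_eq_num q]
      ring
    exact_mod_cast this
  have hodd : Odd (q.num * b) ↔ Odd (a * q.den) := by rw [key]
  simpa [Int.odd_mul, hb, hden] using hodd

theorem odd_den_TO {c : ℤ} (hc : Odd c) {q : ℚ} (hq : Odd q.den) : Odd (TO c q).den := by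
  have hden : Odd (q.den : ℤ) := by exact_mod_cast hq
  have hnum := Rat.mul_den_eq_num q
  unfold TO
  split_ifs with h
  · obtain ⟨k, hk⟩ : Even (3 * q.num + c * q.den) :=
      (Odd.mul (by decide) h).add_odd (hc.mul hden)
    refine Rat.odd_den_of_mul_eq (a := k) hden ?_
    have hk' : (3 * q.num + c * q.den : ℚ) = k + k := by exact_mod_cast hk
    push_cast
    linear_combination (3 / 2 : ℚ) * hnum + hk' / 2
  · obtain ⟨k, hk⟩ := Int.not_odd_iff_even.mp h
    refine Rat.odd_den_of_mul_eq (a := k) hden ?_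
    have hk' : (q.num : ℚ) = k + k := by exact_mod_cast hk
    push_cast
    linear_combination hnum / 2 + hk' / 2

theorem TO_div {c : ℤ} (hc : Odd c) {q : ℚ} (hq : Odd q.den) : TO c q / c = TO 1 (q / c) := by
  have hden : Odd (q.den : ℤ) := by exact_mod_cast hq
  have hc0 : (c : ℚ) ≠ 0 := Int.cast_ne_zero_of_odd hc
  have hiff : Odd (q / c).num ↔ Odd q.num := by
    refine Rat.odd_num_iff_of_mul_eq (hc.mul hden) ?_
    push_cast
    rw [← mul_assoc, div_mul_cancel₀ q hc0, Rat.mul_den_eq_num]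
  unfold TO
  simp only [hiff]
  split_ifs
  · push_cast
    field_simp
  · ring

/-- For `O ≡ ±1 (mod 6)`, the iterates of `T_O` are conjugate to those of the
shortcut Collatz map `T_0 = T 1` via multiplication by `O`:
`T_O^[l] q = O · T_0^[l] (q / O)`. -/
theorem TO_iterate_conj (O : ℤ) (hO : O ≡ 1 [ZMOD 6] ∨ O ≡ -1 [ZMOD 6])
    (q : ℚ) (hden : Odd q.den) (l : ℕ) :
    (TO O)^[l] q = O * (TO 1)^[l] (q / O) := by
  have hodd : Odd O := by
    rw [Int.odd_iff]
    rcases hO with h | h <;> unfold Int.ModEq at h <;> omega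
  have hO0 : (O : ℚ) ≠ 0 := Int.cast_ne_zero_of_odd hodd
  induction l generalizing q with
  | zero => exact (mul_div_cancel₀ q hO0).symm
  | succ l ih =>
    rw [Function.iterate_succ_apply, Function.iterate_succ_apply, ih _ (odd_den_TO hodd hden),
      TO_div hodd hden]
end

section
/- For every integer O with O ≡ 1 or O ≡ -1 (mod 6), every natural number k, every rational number q with odd reduced denominator, and every iteration count l, the iterates satisfy T_{3^k·O}^[l](q) = 3^k · T_O^[l](q / 3^k). -/
/-- Multiplication by an odd integer does not change the parity of the numerator of a rational. -/
theorem Rat.odd_num_intCast_mul_iff {a : ℤ} (ha : Odd a) (q : ℚ) :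
    Odd (a * q : ℚ).num ↔ Odd q.num := by
  have odd_den {r : ℚ} (hr : Even r.num) : Odd (r.den : ℤ) := by
    rw [← Int.not_even_iff_odd]
    intro hd
    exact Nat.not_coprime_of_dvd_of_dvd one_lt_two (Int.natCast_dvd.mp hr.two_dvd)
      (Int.natCast_dvd_natCast.mp hd.two_dvd) r.reduced
  have h : (a * q : ℚ).num * (q.den : ℤ) = a * q.num * ((a * q : ℚ).den : ℤ) := by
    have hq : (q.num : ℚ) = q * q.den := (Rat.mul_den_eq_num q).symm
    have haq : ((a * q : ℚ).num : ℚ) = a * q * (a * q : ℚ).den :=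
      (Rat.mul_den_eq_num (a * q)).symm
    have : ((a * q : ℚ).num : ℚ) * q.den = a * q.num * (a * q : ℚ).den := by
      rw [haq, hq]; ring
    exact_mod_cast this
  have hparity := congrArg Odd h
  simp only [Int.odd_mul, ha, true_and, eq_iff_iff] at hparity
  constructor
  · intro hr
    by_contra hq
    exact hq (hparity.mp ⟨hr, odd_den (Int.not_odd_iff_even.mp hq)⟩).1
  · intro hq
    by_contra hr
    exact hr (hparity.mpr ⟨hq, odd_den (Int.not_odd_iff_even.mp hr)⟩).1

/-- Multiplication by an odd integer `a` semiconjugates `TO c` to `TO (a * c)`. -/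
theorem semiconj_intCast_mul_TO {a : ℤ} (ha : Odd a) (c : ℤ) :
    Function.Semiconj (fun q : ℚ => a * q) (TO c) (TO (a * c)) := by
  intro q
  simp only [TO, Rat.odd_num_intCast_mul_iff ha]
  split_ifs
  · push_cast; ring
  · ring

/-- For `O ≡ ±1 (mod 6)`, the iterates of `T_{3^k·O}` are conjugate to those
of `T_O` via multiplication by `3^k`:
`T_{3^k·O}^[l] q = 3^k · T_O^[l] (q / 3^k)`. -/
theorem T3kO_iterate_conj (O : ℤ) (hO : O ≡ 1 [ZMOD 6] ∨ O ≡ -1 [ZMOD 6])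
    (k : ℕ) (q : ℚ) (hden : Odd q.den) (l : ℕ) :
    (TO (3 ^ k * O))^[l] q = 3 ^ k * (TO O)^[l] (q / 3 ^ k) := by
  have ha : Odd ((3 : ℤ) ^ k) := (by decide : Odd (3 : ℤ)).pow
  have h := (semiconj_intCast_mul_TO ha O).iterate_right l (q / 3 ^ k)
  have hq : (((3 : ℤ) ^ k : ℤ) : ℚ) * (q / 3 ^ k) = q := by
    push_cast
    exact mul_div_cancel₀ q (by positivity)
  simp only [hq] at h
  simpa using h.symm
end

section
/- Let O be an integer with O ≡ 1 or O ≡ -1 (mod 6) and let k be a natural number. Every integral cycle of T_{3^k·O} is 3^k times an integral cycle of T_O: if q is a nonzero integer, l ≥ 1, and T_{3^k·O}^[l](q) = q, then 3^k divides q and T_O^[l](q / 3^k) = q / 3^k. -/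
/-- The `3n + c` map on the integers with odd constant `c`:
`T c q = (3q + c)/2` if `q` is odd, and `q/2` otherwise. -/
def TOZ (c : ℤ) (q : ℤ) : ℤ := if Odd q then (3 * q + c) / 2 else q / 2

theorem TOZ_odd_two_mul {c q : ℤ} (hc : Odd c) (h : Odd q) : 2 * TOZ c q = 3 * q + c := by
  rw [TOZ, if_pos h]
  obtain ⟨a, rfl⟩ := hc
  obtain ⟨b, rfl⟩ := h
  omega

theorem TOZ_even_two_mul {c q : ℤ} (h : ¬Odd q) : 2 * TOZ c q = q := by
  rw [TOZ, if_neg h]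
  obtain ⟨b, rfl⟩ := Int.not_odd_iff_even.mp h
  omega

theorem TOZ_three_mul {c : ℤ} (hc : Odd c) (q : ℤ) : TOZ (3 * c) (3 * q) = 3 * TOZ c q := by
  have h3 : Odd (3 : ℤ) := by decide
  by_cases h : Odd q
  · have h₁ := TOZ_odd_two_mul hc h
    have h₂ := TOZ_odd_two_mul (h3.mul hc) (h3.mul h)
    omega
  · have h₁ := TOZ_even_two_mul (c := c) h
    have h₂ := TOZ_even_two_mul (c := 3 * c) (q := 3 * q) fun h' => h (Int.odd_mul.mp h').2
    omega

/-- An iterate of `T_{3c}` is a multiple of `3`, unless only halving steps were taken. -/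
theorem three_dvd_iterate_TOZ_or {c : ℤ} (hc : Odd c) (q : ℤ) (l : ℕ) :
    3 ∣ (TOZ (3 * c))^[l] q ∨ 2 ^ l * (TOZ (3 * c))^[l] q = q := by
  have h3 : Odd (3 : ℤ) := by decide
  induction l with
  | zero => simp
  | succ l ih =>
    rw [Function.iterate_succ_apply']
    generalize (TOZ (3 * c))^[l] q = x at ih ⊢
    by_cases h : Odd x
    · have h₁ := TOZ_odd_two_mul (h3.mul hc) h
      left
      omega
    · have h₁ := TOZ_even_two_mul (c := 3 * c) h
      refine ih.imp (fun _ => by omega) fun h₂ => ?_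
      rw [pow_succ, mul_assoc, h₁, h₂]

theorem three_dvd_of_iterate_TOZ_eq {c q : ℤ} (hc : Odd c) (hq : q ≠ 0) {l : ℕ} (hl : 1 ≤ l)
    (hper : (TOZ (3 * c))^[l] q = q) : 3 ∣ q := by
  have h := three_dvd_iterate_TOZ_or hc q l
  rw [hper] at h
  refine h.resolve_right fun h₂ => ?_
  have h₃ : (2 : ℤ) ^ l = 1 := mul_right_cancel₀ hq (h₂.trans (one_mul q).symm)
  exact (one_lt_pow₀ (one_lt_two : (1 : ℤ) < 2) (by omega)).ne' h₃

/-- For `O ≡ ±1 (mod 6)`, every integral cycle of `T_{3^k·O}` is `3^k` times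
an integral cycle of `T_O`: if `q ≠ 0` lies on a `T_{3^k·O}`-cycle of length
`l ≥ 1`, then `3^k ∣ q` and `q / 3^k` lies on a `T_O`-cycle of length `l`. -/
theorem T3kO_cycle_eq_pow_three_mul (O : ℤ)
    (hO : O ≡ 1 [ZMOD 6] ∨ O ≡ -1 [ZMOD 6]) (k : ℕ) (q : ℤ) (hq : q ≠ 0)
    (l : ℕ) (hl : 1 ≤ l) (hper : (TOZ (3 ^ k * O))^[l] q = q) :
    (3 ^ k : ℤ) ∣ q ∧ (TOZ O)^[l] (q / 3 ^ k) = q / 3 ^ k := by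
  have hodd : Odd O := by
    rw [Int.odd_iff]
    rcases hO with h | h <;> unfold Int.ModEq at h <;> omega
  induction k generalizing q with
  | zero => simpa using hper
  | succ k ih =>
    have hc : Odd (3 ^ k * O) := ((by decide : Odd (3 : ℤ)).pow).mul hodd
    rw [pow_succ', mul_assoc] at hper
    obtain ⟨r, rfl⟩ := three_dvd_of_iterate_TOZ_eq hc hq hl hper
    have hsemi : Function.Semiconj (3 * ·) (TOZ (3 ^ k * O)) (TOZ (3 * (3 ^ k * O))) :=
      fun x => (TOZ_three_mul hc x).symm
    have hr : (TOZ (3 ^ k * O))^[l] r = r :=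
      mul_left_cancel₀ three_ne_zero (((hsemi.iterate_right l).eq r).trans hper)
    obtain ⟨hdvd, heq⟩ := ih r (right_ne_zero_of_mul hq) hr
    rw [pow_succ', Int.mul_ediv_mul_of_pos _ _ three_pos]
    exact ⟨mul_dvd_mul_left 3 hdvd, heq⟩
end

section
/- Let O be an integer with O ≡ 1 or O ≡ -1 (mod 6) and let k be a natural number. Every integral cycle of T_O gives rise, after multiplication by 3^k, to an integral cycle of T_{3^k·O}: if q' is an integer with T_O^[l](q') = q' for some l ≥ 1, then T_{3^k·O}^[l](3^k · q') = 3^k · q'. -/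
/-- Multiplication by an odd integer `m` intertwines `T_c` and `T_{m·c}`, for odd `c`. -/
theorem TOZ_semiconj_mul_left {m c : ℤ} (hm : Odd m) (hc : Odd c) :
    Function.Semiconj (m * ·) (TOZ c) (TOZ (m * c)) := by
  intro q
  by_cases hq : Odd q
  · have h2 : 2 ∣ 3 * q + c :=
      (((by decide : Odd (3 : ℤ)).mul hq).add_odd hc).two_dvd
    simp only [TOZ, hq, hm.mul hq, if_true]
    rw [← Int.mul_ediv_assoc _ h2]
    ring_nf
  · have h2 : 2 ∣ q := (Int.not_odd_iff_even.mp hq).two_dvd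
    have hmq : ¬ Odd (m * q) := fun h => hq (Int.odd_mul.mp h).2
    simp only [TOZ, hq, hmq, if_false]
    exact (Int.mul_ediv_assoc _ h2).symm

/-- For `O ≡ ±1 (mod 6)`, every integral cycle of `T_O` gives, after
multiplication by `3^k`, an integral cycle of `T_{3^k·O}`. -/
theorem pow_three_mul_cycle_T3kO (O : ℤ)
    (hO : O ≡ 1 [ZMOD 6] ∨ O ≡ -1 [ZMOD 6]) (k : ℕ) (q' : ℤ) (l : ℕ)
    (hl : 1 ≤ l) (hper : (TOZ O)^[l] q' = q') :
    (TOZ (3 ^ k * O))^[l] (3 ^ k * q') = 3 ^ k * q' := by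
  have hOdd : Odd O := by
    rw [Int.odd_iff]
    rcases hO with h | h <;> (unfold Int.ModEq at h; omega)
  have hpow : Odd ((3 : ℤ) ^ k) := (by decide : Odd (3 : ℤ)).pow
  have h := (TOZ_semiconj_mul_left hpow hOdd).iterate_right l q'
  simpa only [hper] using h.symm
end

section
/- For every integer O with O ≡ 1 or O ≡ -1 (mod 6), O is not divisible by 3, and consequently for every rational periodic point q of T_{3^k·O} on the integers the quotient q/(3^k·O) is a rational periodic point of T_0 with denominator whose 3-part equals the 3-part of 3^k·O divided by gcd(q, 3^k·O): concretely, if q is a nonzero integer with T_{3^k·O}^[l](q) = q for some l ≥ 1, then q/(3^k·O) is a rational number with odd denominator satisfying T_0^[l](q/(3^k·O)) = q/(3^k·O). -/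
theorem Rat.odd_den_intCast_div_of_odd {c : ℤ} (hc : Odd c) (q : ℤ) :
    Odd ((q : ℚ) / (c : ℚ)).den := by
  have h : (((q : ℚ) / (c : ℚ)).den : ℤ) ∣ c := by
    rw [← Rat.divInt_eq_div]
    exact Rat.den_dvd q c
  obtain ⟨m, hm⟩ := h
  rw [hm, Int.odd_mul] at hc
  exact (Int.odd_coe_nat _).1 hc.1

theorem Rat.odd_num_intCast_div_iff {c : ℤ} (hc : Odd c) (q : ℤ) :
    Odd ((q : ℚ) / (c : ℚ)).num ↔ Odd q := by
  have hden : Odd (((q : ℚ) / (c : ℚ)).den : ℤ) :=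
    (Int.odd_coe_nat _).2 (Rat.odd_den_intCast_div_of_odd hc q)
  have hc0 : (c : ℚ) ≠ 0 := by
    rintro h
    have : c = 0 := by exact_mod_cast h
    simp [this] at hc
  have hd0 : (((q : ℚ) / (c : ℚ)).den : ℚ) ≠ 0 := by
    exact_mod_cast ((q : ℚ) / (c : ℚ)).den_nz
  have h : ((q : ℚ) / (c : ℚ)).num * c = q * (((q : ℚ) / (c : ℚ)).den : ℤ) := by
    have h' := Rat.num_div_den ((q : ℚ) / (c : ℚ))
    rw [div_eq_div_iff hd0 hc0] at h'
    exact_mod_cast h'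
  have hodd := congrArg Odd h
  simpa only [Int.odd_mul, hc, hden, and_true, eq_iff_iff] using hodd

theorem semiconj_TOZ_T0Q {c : ℤ} (hc : Odd c) :
    Function.Semiconj (fun q : ℤ => (q : ℚ) / (c : ℚ)) (TOZ c) T0Q := by
  intro q
  have hc0 : (c : ℚ) ≠ 0 := by
    rintro h
    have : c = 0 := by exact_mod_cast h
    simp [this] at hc
  simp only [TOZ, T0Q, Rat.odd_num_intCast_div_iff hc]
  split_ifs with hq
  · have h2 : (2 : ℤ) ∣ 3 * q + c := by
      obtain ⟨a, rfl⟩ := hq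
      obtain ⟨b, rfl⟩ := hc
      omega
    rw [Int.cast_div h2 (by norm_num)]
    push_cast
    field_simp
  · have h2 : (2 : ℤ) ∣ q := (Int.not_odd_iff_even.1 hq).two_dvd
    rw [Int.cast_div h2 (by norm_num)]
    push_cast
    field_simp

/-- For `O ≡ ±1 (mod 6)`, `O` is not divisible by `3`; consequently, for every
nonzero integer `q` lying on a `T_{3^k·O}`-cycle of length `l ≥ 1`, the
rational number `q / (3^k·O)` has odd reduced denominator and is a periodic
point of period `l` of the rational shortcut Collatz map `T₀`. -/
theorem TO_not_three_dvd_and_periodic (O : ℤ)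
    (hO : O ≡ 1 [ZMOD 6] ∨ O ≡ -1 [ZMOD 6]) :
    ¬ (3 ∣ O) ∧
    ∀ (k : ℕ) (q : ℤ) (l : ℕ), q ≠ 0 → 1 ≤ l →
      (TOZ (3 ^ k * O))^[l] q = q →
      Odd ((q : ℚ) / ((3 ^ k * O : ℤ) : ℚ)).den ∧
      T0Q^[l] ((q : ℚ) / ((3 ^ k * O : ℤ) : ℚ)) =
        (q : ℚ) / ((3 ^ k * O : ℤ) : ℚ) := by
  refine ⟨by rcases hO with h | h <;> simp only [Int.ModEq] at h <;> omega, ?_⟩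
  intro k q l _ _ hper
  have hOodd : Odd O := by
    rw [Int.odd_iff]
    rcases hO with h | h <;> simp only [Int.ModEq] at h <;> omega
  have hc : Odd (3 ^ k * O) := (Odd.pow (by decide)).mul hOodd
  refine ⟨Rat.odd_den_intCast_div_of_odd hc q, ?_⟩
  have h := (semiconj_TOZ_T0Q hc).iterate_right l q
  rw [hper] at h
  exact h.symm
end
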